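/- Let (G, sI, λ) be a synthesis game for a specification φ ⊆ Σ^ω with parity objective Φ = Parity(p), and let El ⊆ E2 be a strongly fair assumption that is sufficient for sI and Φ (i.e., sI ∈ Win1(AssumeFair(El,Φ))). Then the environment assumption ψ_El is a sufficient environment assumption for φ, i.e., (Σ^ω ∖ ψ_El) ∪ φ is Moore realizable; moreover ψ_El is realizable for the environment. -/

import Mathlib

open scoped Classical
noncomputable section

/-! ### Deterministic two-player games on graphs -/

/-- The set of states occurring infinitely often in a play. -/
def infSet {S : Type} (π : ℕ → S) : Set S :=
  {t | ∀ N : ℕ, ∃ k : ℕ, N ≤ k ∧ π k = t}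

/-- Parity objective: the minimal priority occurring infinitely often is even. -/
def ParityObj {S : Type} (p : S → ℕ) : Set (ℕ → S) :=
  {π | Even (sInf (p '' infSet π))}

/-- Co-parity objective: the minimal priority occurring infinitely often is odd.
This is the complement of `ParityObj p`. -/
def CoparityObj {S : Type} (p : S → ℕ) : Set (ℕ → S) :=
  {π | Odd (sInf (p '' infSet π))}

/-- Safety objective: only states of `F` are visited. -/
def SafeObj {S : Type} (F : Set S) : Set (ℕ → S) := {π | ∀ k : ℕ, π k ∈ F}

/-- Reachability objective: some state of `F` is visited. -/
def ReachObj {S : Type} (F : Set S) : Set (ℕ → S) := {π | ∃ k : ℕ, π k ∈ F}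

/-- Büchi objective: some state of `F` is visited infinitely often. -/
def BuchiObj {S : Type} (F : Set S) : Set (ℕ → S) := {π | ∃ t ∈ F, t ∈ infSet π}

/-- A deterministic game graph: a finite directed graph in which every state
has at least one successor, together with the set `S1` of player-1 states
(the remaining states belong to player 2). -/
structure DetGame (S : Type) [Fintype S] where
  E : S → S → Prop
  S1 : Set S
  exists_succ : ∀ s : S, ∃ t : S, E s t

namespace DetGame

variable {S : Type} [Fintype S]

/-- Player-2 states. -/
def S2 (G : DetGame S) : Set S := G.S1ᶜ

/-- A play: an infinite sequence of states following edges. -/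
def IsPlay (G : DetGame S) (π : ℕ → S) : Prop := ∀ k : ℕ, G.E (π k) (π (k + 1))

/-- A strategy for player 1: given the history of states strictly before the
current state, and the current state, it chooses a successor, which must be
along an edge whenever the current state is a player-1 state. -/
structure Strat1 (G : DetGame S) where
  f : List S → S → S
  valid : ∀ (h : List S) (s : S), s ∈ G.S1 → G.E s (f h s)

/-- A strategy for player 2. -/
structure Strat2 (G : DetGame S) where
  f : List S → S → S
  valid : ∀ (h : List S) (s : S), s ∈ G.S2 → G.E s (f h s)

/-- A memoryless strategy depends only on the current state. -/
def Strat1.Memoryless {G : DetGame S} (α : Strat1 G) : Prop :=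
  ∀ (h h' : List S) (s : S), α.f h s = α.f h' s

def Strat2.Memoryless {G : DetGame S} (β : Strat2 G) : Prop :=
  ∀ (h h' : List S) (s : S), β.f h s = β.f h' s

/-- The (history, current state) pair after `k` steps of the play from `s`
where player 1 follows `α` and player 2 follows `β`. -/
def histPair (G : DetGame S) (α : Strat1 G) (β : Strat2 G) (s : S) :
    ℕ → List S × S
  | 0 => ([], s)
  | k + 1 =>
    let p := histPair G α β s k
    (p.1 ++ [p.2], if p.2 ∈ G.S1 then α.f p.1 p.2 else β.f p.1 p.2)

/-- The unique play from `s` when player 1 follows `α` and player 2 follows `β`. -/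
def outcome (G : DetGame S) (s : S) (α : Strat1 G) (β : Strat2 G) : ℕ → S :=
  fun k => (histPair G α β s k).2

/-- Sure winning set of player 1 for objective `Φ`. -/
def Win1 (G : DetGame S) (Φ : Set (ℕ → S)) : Set S :=
  {s | ∃ α : Strat1 G, ∀ β : Strat2 G, G.outcome s α β ∈ Φ}

/-- Sure winning set of player 2 for objective `Φ`. -/
def Win2 (G : DetGame S) (Φ : Set (ℕ → S)) : Set S :=
  {s | ∃ β : Strat2 G, ∀ α : Strat1 G, G.outcome s α β ∈ Φ}

/-- Cooperative winning set: both players together can achieve `Φ`. -/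
def Win12 (G : DetGame S) (Φ : Set (ℕ → S)) : Set S :=
  {s | ∃ (α : Strat1 G) (β : Strat2 G), G.outcome s α β ∈ Φ}

/-- The set of player-2 edges. -/
def E2 (G : DetGame S) : Set (S × S) := {e | G.E e.1 e.2 ∧ e.1 ∈ G.S2}

/-- The objective "either some forbidden edge of `Es` is taken, or the play
remains in the safety component `Safe(Win12(Φ))` of `Φ`". -/
def AssumeSafe (G : DetGame S) (Es : Set (S × S)) (Φ : Set (ℕ → S)) :
    Set (ℕ → S) :=
  {π | (∃ i : ℕ, (π i, π (i + 1)) ∈ Es) ∨ π ∈ SafeObj (G.Win12 Φ)}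

/-- A safety assumption `Es` is safe-sufficient for a state `s` and an
objective `Φ` if player 1 wins `AssumeSafe Es Φ` from `s`. -/
def SafeSufficient (G : DetGame S) (Es : Set (S × S)) (s : S)
    (Φ : Set (ℕ → S)) : Prop :=
  s ∈ G.Win1 (G.AssumeSafe Es Φ)

/-- A safety assumption `Es` is restrictive for `s` and `Φ` if some pair of
strategies produces a play that uses an edge of `Es` and stays in the safety
component of `Φ`. -/
def Restrictive (G : DetGame S) (Es : Set (S × S)) (s : S)
    (Φ : Set (ℕ → S)) : Prop :=
  ∃ (α : Strat1 G) (β : Strat2 G),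
    (∃ i : ℕ, (G.outcome s α β i, G.outcome s α β (i + 1)) ∈ Es) ∧
      G.outcome s α β ∈ SafeObj (G.Win12 Φ)

/-- The objective "either the strong fairness assumption on `El` is violated
(some source state of an edge in `El` repeats forever while the target of
that edge does not), or `Φ` holds". -/
def AssumeFair (G : DetGame S) (El : Set (S × S)) (Φ : Set (ℕ → S)) :
    Set (ℕ → S) :=
  {π | (∃ e ∈ El, e.1 ∈ infSet π ∧ e.2 ∉ infSet π) ∨ π ∈ Φ}

end DetGame

/-! ### Transducers and synthesis games -/

/-- A Moore transducer with input alphabet `Set I` and output alphabet `Set O`. -/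
structure Moore (I O : Type) where
  Q : Type
  fin : Finite Q
  qI : Q
  tr : Q → Set I → Q
  out : Q → Set O

namespace Moore

variable {I O : Type} (T : Moore I O)

/-- The run of the transducer over an infinite input word. -/
def run (w : ℕ → Set I) : ℕ → T.Q
  | 0 => T.qI
  | i + 1 => T.tr (run w i) (w i)

/-- The infinite word over `Set I × Set O` generated by the run on `w`. -/
def output (w : ℕ → Set I) : ℕ → Set I × Set O :=
  fun i => (w i, T.out (T.run w i))

/-- The language of the transducer. -/
def lang : Set (ℕ → Set I × Set O) := {x | ∃ w : ℕ → Set I, x = T.output w}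

end Moore

/-- A specification is (Moore) realizable if some Moore transducer
implements it. -/
def MooreRealizable {I O : Type} (L : Set (ℕ → Set I × Set O)) : Prop :=
  ∃ T : Moore I O, T.lang ⊆ L

/-- `ψ` is a sufficient environment assumption for `φ` if `ψᶜ ∪ φ` is
(Moore) realizable. -/
def SufficientAssumption {I O : Type} (φ ψ : Set (ℕ → Set I × Set O)) : Prop :=
  MooreRealizable (ψᶜ ∪ φ)

/-- A Mealy transducer with input alphabet `Set O` and output alphabet `Set I`
(an environment). -/
structure Mealy (I O : Type) where
  Q : Type
  fin : Finite Q
  qI : Q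
  tr : Q → Set O → Q
  out : Q → Set O → Set I

namespace Mealy

variable {I O : Type} (T : Mealy I O)

def run (w : ℕ → Set O) : ℕ → T.Q
  | 0 => T.qI
  | i + 1 => T.tr (run w i) (w i)

def output (w : ℕ → Set O) : ℕ → Set I × Set O :=
  fun i => (T.out (T.run w i) (w i), w i)

def lang : Set (ℕ → Set I × Set O) := {x | ∃ w : ℕ → Set O, x = T.output w}

end Mealy

/-- `ψ` is realizable for the environment if some Mealy transducer with
input alphabet `Set O` and output alphabet `Set I` implements it. -/
def EnvRealizable {I O : Type} (ψ : Set (ℕ → Set I × Set O)) : Prop :=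
  ∃ T : Mealy I O, T.lang ⊆ ψ

/-- A synthesis game: a bipartite deterministic game graph with an initial
player-1 state, whose player-1 states are labeled by input letters and whose
player-2 states are labeled by output letters, deterministic and complete
with respect to the labels. -/
structure SynthGame (S : Type) [Fintype S] (I O : Type) extends DetGame S where
  sI : S
  sI_mem : sI ∈ S1
  bipartite : ∀ s t : S, E s t → (s ∈ S1 ∧ t ∉ S1) ∨ (s ∉ S1 ∧ t ∈ S1)
  labI : S → Set I
  labO : S → Set O
  labelDet1 : ∀ s t t' : S, s ∈ S1 → E s t → E s t' → labO t = labO t' → t = t'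
  labelDet2 : ∀ s t t' : S, s ∉ S1 → E s t → E s t' → labI t = labI t' → t = t'
  complete1 : ∀ s ∈ S1, ∀ o : Set O, ∃ t : S, E s t ∧ labO t = o
  complete2 : ∀ s ∉ S1, ∀ i : Set I, ∃ t : S, E s t ∧ labI t = i

namespace SynthGame

variable {S I O : Type} [Fintype S] (SG : SynthGame S I O)

/-- The infinite word over `Set I × Set O` corresponding to a play from `sI`. -/
def word (π : ℕ → S) : ℕ → Set I × Set O :=
  fun i => (SG.labI (π (2 * i + 2)), SG.labO (π (2 * i + 1)))

/-- `SG` with priority function `p` is a synthesis game for the specification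
`φ`: a play from `sI` satisfies the parity objective iff its word is in `φ`. -/
def IsGameFor (p : S → ℕ) (φ : Set (ℕ → Set I × Set O)) : Prop :=
  ∀ π : ℕ → S, SG.toDetGame.IsPlay π → π 0 = SG.sI →
    (π ∈ ParityObj p ↔ SG.word π ∈ φ)

/-- The environment assumption defined by a safety assumption `Es`:
words of plays from `sI` never using an edge of `Es`. -/
def psiSafety (Es : Set (S × S)) : Set (ℕ → Set I × Set O) :=
  {w | ∃ π : ℕ → S, SG.toDetGame.IsPlay π ∧ π 0 = SG.sI ∧ SG.word π = w ∧
    ∀ i : ℕ, (π i, π (i + 1)) ∉ Es}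

/-- The environment assumption defined by a strongly fair assumption `El`:
words of plays from `sI` in which, for every edge of `El`, either the source
occurs only finitely often or the edge is taken infinitely often. -/
def psiFair (El : Set (S × S)) : Set (ℕ → Set I × Set O) :=
  {w | ∃ π : ℕ → S, SG.toDetGame.IsPlay π ∧ π 0 = SG.sI ∧ SG.word π = w ∧
    ∀ e ∈ El, e.1 ∉ infSet π ∨
      ∀ N : ℕ, ∃ k : ℕ, N ≤ k ∧ π k = e.1 ∧ π (k + 1) = e.2}

end SynthGame

namespace RG

variable {S : Type}

def Step {M : Type} (S1 : Set S) (E : S → Set S) (upd : M → S → S → M) (ch : M → S → S)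
    (x : S) (m : M) (y : S) (m' : M) : Prop :=
  m' = upd m x y ∧ (x ∈ S1 → y ∈ E x) ∧ (x ∉ S1 → y = ch m x)

def W2 (S1 : Set S) (E : S → Set S) (L : Set S → Prop) (s : S) : Prop :=
  ∃ (M : Type) (m0 : M) (upd : M → S → S → M) (ch : M → S → S),
    (∀ m x, x ∉ S1 → ch m x ∈ E x) ∧
    ∀ (π : ℕ → S) (m : ℕ → M), π 0 = s → m 0 = m0 →
      (∀ k, Step S1 E upd ch (π k) (m k) (π (k+1)) (m (k+1))) → L (infSet π)

def P1 (S1 : Set S) (E : S → Set S) (L : Set S → Prop) (s : S) : Prop :=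
  ∃ f : S → S, (∀ x ∈ S1, f x ∈ E x) ∧
    ∀ π : ℕ → S, π 0 = s →
      (∀ k, (π k ∈ S1 → π (k+1) = f (π k)) ∧ (π k ∉ S1 → π (k+1) ∈ E (π k))) →
      ¬ L (infSet π)

theorem infSet_shift (a : ℕ → S) (n : ℕ) : infSet (fun j => a (j + n)) = infSet a := by
  ext t
  constructor
  · intro h N
    obtain ⟨k, hk, e⟩ := h N
    exact ⟨k + n, by omega, e⟩
  · intro h N
    obtain ⟨k, hk, e⟩ := h (N + n)
    refine ⟨k - n, by omega, ?_⟩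
    show a (k - n + n) = t
    rw [Nat.sub_add_cancel (by omega)]; exact e

theorem base (S1 : Set S) (E : S → Set S) (L : Set S → Prop) (s : S)
    (hne : ∀ x, (E x).Nonempty) (hsub : ∀ x ∈ S1, (E x).Subsingleton) :
    P1 S1 E L s ∨ W2 S1 E L s := by
  choose f hf using hne
  by_cases h : ∀ π : ℕ → S, π 0 = s →
      (∀ k, (π k ∈ S1 → π (k+1) = f (π k)) ∧ (π k ∉ S1 → π (k+1) ∈ E (π k))) →
      ¬ L (infSet π)
  · exact Or.inl ⟨f, fun x _ => hf x, h⟩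
  · right
    push Not at h
    obtain ⟨π, h0, hπ, hL⟩ := h
    refine ⟨ℕ, 0, fun m _ _ => m + 1,
      fun m x => if π m = x then π (m+1) else f x, ?_, ?_⟩
    · intro m x hx
      dsimp only
      split_ifs with e
      · subst e; exact (hπ m).2 hx
      · exact hf x
    · intro ρ m hρ0 hm0 hst
      have key : ∀ k, ρ k = π k ∧ m k = k := by
        intro k
        induction k with
        | zero => exact ⟨by rw [hρ0, h0], hm0⟩
        | succ k ih =>
          obtain ⟨a, b, c⟩ := hst k
          obtain ⟨i1, i2⟩ := ih
          refine ⟨?_, by rw [a, i2]⟩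
          by_cases hx : ρ k ∈ S1
          · have h1 := b hx
            rw [i1] at hx h1
            rw [(hπ k).1 hx]
            exact hsub _ hx h1 (hf _)
          · have h1 := c hx
            rw [h1, i1, i2]; simp
      have : ρ = π := funext fun k => (key k).1
      rw [this]; exact hL

theorem avoid (S1 : Set S) (E : S → Set S) (L : Set S → Prop) (s sI : S) (B : Set S)
    (hs : s ∈ S1)
    (h1 : P1 S1 (Function.update E s B) L s)
    (h2 : W2 S1 (Function.update E s B) L sI) : W2 S1 E L sI := by
  obtain ⟨f, hf, hfw⟩ := h1
  obtain ⟨M, m0, upd, ch, hch, hw⟩ := h2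
  refine ⟨M, m0, upd, ch, ?_, ?_⟩
  · intro m x hx
    have := hch m x hx
    rwa [Function.update_of_ne (by rintro rfl; exact hx hs)] at this
  · intro π m hπ0 hm0 hst
    have hnv : ∀ k, π k ≠ s := by
      by_contra hcon
      push Not at hcon
      let k := Nat.find hcon
      have hk : π k = s := Nat.find_spec hcon
      have hmin : ∀ j < k, π j ≠ s := fun j hj => Nat.find_min hcon hj
      let g : S × M → S × M := fun q =>
        let y := if q.1 ∈ S1 then f q.1 else ch q.2 q.1
        (y, upd q.2 q.1 y)
      let sq : ℕ → S × M := fun j => g^[j] (s, m k)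
      have hsq : ∀ j, sq (j+1) = g (sq j) := fun j => Function.iterate_succ_apply' g j _
      let σ : ℕ → S × M := fun j => if j < k then (π j, m j) else sq (j - k)
      have hσle : ∀ j ≤ k, σ j = (π j, m j) := by
        intro j hj
        rcases hj.lt_or_eq with h | h
        · simp only [σ, if_pos h]
        · simp only [σ, h, lt_irrefl, if_false, Nat.sub_self]
          show (s, m k) = _
          rw [hk]
      have hσge : ∀ j, σ (j + k) = sq j := by
        intro j
        simp [σ]
      have hL : L (infSet (fun j => (σ j).1)) := by
        apply hw _ (fun j => (σ j).2)
        · simp [hσle 0 (Nat.zero_le _), hπ0]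
        · simp [hσle 0 (Nat.zero_le _), hm0]
        · intro j
          by_cases hj : j < k
          · rw [hσle j hj.le, hσle (j+1) hj]
            obtain ⟨a, b, c⟩ := hst j
            refine ⟨a, ?_, c⟩
            rw [Function.update_of_ne (hmin j hj)]
            exact b
          · obtain ⟨i, rfl⟩ : ∃ i, j = i + k := ⟨j - k, by omega⟩
            rw [show i + k + 1 = (i + 1) + k by omega, hσge, hσge, hsq]
            refine ⟨rfl, ?_, ?_⟩
            · intro hx
              simp only [g, if_pos hx]
              exact hf _ hx
            · intro hx
              simp only [g, if_neg hx]
      have hL' : ¬ L (infSet (fun j => (sq j).1)) := by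
        apply hfw
        · rfl
        · intro j
          rw [hsq]
          refine ⟨?_, ?_⟩
          · intro hx
            simp only [g, if_pos hx]
          · intro hx
            simp only [g, if_neg hx]
            exact hch _ _ hx
      apply hL'
      rw [← infSet_shift _ k] at hL
      simpa only [hσge] using hL
    apply hw π m hπ0 hm0
    intro k
    obtain ⟨a, b, c⟩ := hst k
    refine ⟨a, ?_, c⟩
    rw [Function.update_of_ne (hnv k)]
    exact b

theorem gap {α : Type} (P : ℕ → Prop) (hP : (Set.ofPred P).Infinite) (g : ℕ → α)
    (hg : ∀ k, ¬ P k → g (k+1) = g k) :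
    g (Nat.nth P 0) = g 0 ∧ ∀ j, g (Nat.nth P (j+1)) = g (Nat.nth P j + 1) := by
  have aux : ∀ a d, (∀ i, a ≤ i → i < a + d → ¬ P i) → g (a + d) = g a := by
    intro a d
    induction d with
    | zero => intro _; rfl
    | succ d ih =>
      intro h
      rw [← add_assoc, hg _ (h _ (by omega) (by omega))]
      exact ih fun i h1 h2 => h i h1 (by omega)
  constructor
  · have := aux 0 (Nat.nth P 0) (by
      intro i _ hi hPi
      rw [zero_add] at hi
      have := Nat.lt_nth_iff_count_lt (p := P) hP (a := 0) (b := i)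
      have h2 := Nat.nth_count hPi
      have h3 : Nat.nth P 0 ≤ Nat.nth P (Nat.count P i) := Nat.nth_monotone hP (Nat.zero_le _)
      omega)
    simpa using this
  · intro j
    have hlt : Nat.nth P j < Nat.nth P (j+1) := Nat.nth_strictMono hP (Nat.lt_succ_self j)
    have := aux (Nat.nth P j + 1) (Nat.nth P (j+1) - (Nat.nth P j + 1)) (by
      intro i h1 h2 hPi
      have e := Nat.nth_count hPi
      have h3 : Nat.nth P j < Nat.nth P (Nat.count P i) := by omega
      have h4 : Nat.nth P (Nat.count P i) < Nat.nth P (j+1) := by omega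
      have h5 := (Nat.nth_strictMono hP).lt_iff_lt.1 h3
      have h6 := (Nat.nth_strictMono hP).lt_iff_lt.1 h4
      omega)
    rw [← this]; congr 1; omega

theorem project {M : Type} (S1 : Set S) (E : S → Set S) (upd : M → S → S → M) (ch : M → S → S)
    (L : Set S → Prop) (x0 : S) (m0 : M) (s : S)
    (hw : ∀ (π : ℕ → S) (m : ℕ → M), π 0 = x0 → m 0 = m0 →
      (∀ k, Step S1 E upd ch (π k) (m k) (π (k+1)) (m (k+1))) → L (infSet π))
    (π : ℕ → S) (m : ℕ → M) (P : ℕ → Prop) (hP : (Set.ofPred P).Infinite) (hm0 : m 0 = m0)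
    (hst : ∀ k, P k → Step S1 E upd ch (π k) (m k) (π (k+1)) (m (k+1)))
    (hfr : ∀ k, ¬ P k → m (k+1) = m k)
    (hsw : ∀ k, π (k+1) ≠ s → (P (k+1) ↔ P k))
    (hi1 : P 0 → π 0 = x0) (hi2 : ¬ P 0 → x0 = s) :
    L {t | ∀ N : ℕ, ∃ k, N ≤ k ∧ P k ∧ π k = t} := by
  let r : ℕ → S := fun k => Nat.rec x0 (fun k y => if P k then π (k+1) else y) k
  have hr0 : r 0 = x0 := rfl
  have hrs : ∀ k, r (k+1) = if P k then π (k+1) else r k := fun k => rfl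
  have inv : ∀ k, (P k → r k = π k) ∧ (¬ P k → r k = s) := by
    intro k
    induction k with
    | zero => exact ⟨fun h => by rw [hr0, hi1 h], fun h => by rw [hr0, hi2 h]⟩
    | succ k ih =>
      have h := hsw k
      have h2 := hrs k
      by_cases h3 : P k
      · rw [if_pos h3] at h2
        refine ⟨fun _ => h2, fun h4 => ?_⟩
        rw [h2]; by_contra h5; exact h4 ((h h5).2 h3)
      · rw [if_neg h3] at h2
        refine ⟨fun h4 => ?_, fun h4 => ?_⟩
        · rw [h2, ih.2 h3]; by_contra h5; exact h3 ((h (Ne.symm h5)).1 h4)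
        · rw [h2, ih.2 h3]
  obtain ⟨g0, gs⟩ := gap P hP (fun k => (r k, m k)) (by
    intro k hk; simp [hrs, hk, hfr])
  simp only [Prod.mk.injEq] at g0 gs
  have hmem : ∀ j, P (Nat.nth P j) := fun j => Nat.nth_mem_of_infinite hP j
  have := hw (fun j => r (Nat.nth P j)) (fun j => m (Nat.nth P j))
    (by simp [g0.1, hr0]) (by simp [g0.2, hm0]) (by
      intro j
      show Step S1 E upd ch (r (Nat.nth P j)) (m (Nat.nth P j)) (r (Nat.nth P (j+1)))
        (m (Nat.nth P (j+1)))
      rw [(gs j).1, (gs j).2, (inv _).1 (hmem j), hrs, if_pos (hmem j)]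
      exact hst _ (hmem j))
  convert this using 1
  ext t
  constructor
  · intro h N
    obtain ⟨k, hk, hPk, e⟩ := h (Nat.nth P N)
    refine ⟨Nat.count P k, ?_, ?_⟩
    · rw [← Nat.nth_count hPk] at hk
      exact (Nat.nth_strictMono hP).le_iff_le.1 hk
    · simp only [Nat.nth_count hPk]
      rw [(inv _).1 hPk, e]
  · intro h N
    obtain ⟨j, hj, e⟩ := h N
    refine ⟨Nat.nth P j, hj.trans (Nat.nth_strictMono hP).le_apply, hmem j, ?_⟩
    rw [← (inv _).1 (hmem j)]; exact e

theorem shuffle (S1 : Set S) (E : S → Set S) (L : Set S → Prop)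
    (hL : ∀ U V, L U → L V → L (U ∪ V)) (s sI : S) (A B : Set S)
    (hs : s ∈ S1) (hE : E s ⊆ A ∪ B)
    (h1 : W2 S1 (Function.update E s A) L sI)
    (h2 : W2 S1 (Function.update E s B) L s) : W2 S1 E L sI := by
  obtain ⟨MA, a0, updA, chA, hcA, hwA⟩ := h1
  obtain ⟨MB, b0, updB, chB, hcB, hwB⟩ := h2
  let cm : MA × MB × Prop → S → S → Prop := fun m x y => if x = s then y ∈ A else m.2.2
  refine ⟨MA × MB × Prop, (a0, b0, True),
    fun m x y => (if cm m x y then updA m.1 x y else m.1,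
      if cm m x y then m.2.1 else updB m.2.1 x y, cm m x y),
    fun m x => if m.2.2 then chA m.1 x else chB m.2.1 x, ?_, ?_⟩
  · intro m x hx
    have hne : x ≠ s := by rintro rfl; exact hx hs
    have ha := hcA m.1 x hx
    have hb := hcB m.2.1 x hx
    rw [Function.update_of_ne hne] at ha hb
    dsimp only
    split_ifs
    · exact ha
    · exact hb
  · intro π m hπ0 hm0 hst
    let P : ℕ → Prop := fun k => cm (m k) (π k) (π (k+1))
    have hPs : ∀ k, π k = s → (P k ↔ π (k+1) ∈ A) := by
      intro k hk; simp only [P, cm, if_pos hk]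
    have hPn : ∀ k, π k ≠ s → (P k ↔ (m k).2.2) := by
      intro k hk; simp only [P, cm, if_neg hk]
    have hmA : ∀ k, (m (k+1)).1 = if P k then updA (m k).1 (π k) (π (k+1)) else (m k).1 :=
      fun k => by rw [(hst k).1]
    have hmB : ∀ k, (m (k+1)).2.1 = if P k then (m k).2.1 else updB (m k).2.1 (π k) (π (k+1)) :=
      fun k => by rw [(hst k).1]
    have hmP : ∀ k, (m (k+1)).2.2 = P k := fun k => by rw [(hst k).1]
    have hsw : ∀ k, π (k+1) ≠ s → (P (k+1) ↔ P k) := by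
      intro k hk; rw [hPn _ hk, hmP]
    have h0 : ¬ P 0 → sI = s := by
      intro h; by_contra hc
      apply h
      rw [hPn 0 (by rw [hπ0]; exact hc), hm0]; trivial
    have hA : (Set.ofPred P).Infinite → L {t | ∀ N : ℕ, ∃ k, N ≤ k ∧ P k ∧ π k = t} := by
      intro hinf
      refine project S1 _ updA chA L sI a0 s hwA π (fun k => (m k).1) P hinf (by simp [hm0])
        ?_ ?_ hsw (fun _ => hπ0) h0
      · intro k hk
        refine ⟨by simp [hmA, hk], ?_, ?_⟩
        · intro hx
          by_cases hks : π k = s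
          · rw [hks, Function.update_self]; exact (hPs k hks).1 hk
          · rw [Function.update_of_ne hks]; exact (hst k).2.1 hx
        · intro hx
          have hks : π k ≠ s := fun e => hx (e ▸ hs)
          have := (hst k).2.2 hx
          dsimp only at this
          rw [if_pos ((hPn k hks).1 hk)] at this
          exact this
      · intro k hk; simp [hmA, hk]
    have hB : (Set.ofPred fun k => ¬ P k).Infinite →
        L {t | ∀ N : ℕ, ∃ k, N ≤ k ∧ ¬ P k ∧ π k = t} := by
      intro hinf
      refine project S1 _ updB chB L s b0 s hwB π (fun k => (m k).2.1) (fun k => ¬ P k) hinf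
        (by simp [hm0]) ?_ ?_ (fun k hk => not_congr (hsw k hk))
        (fun h => hπ0.trans (h0 h)) (fun _ => rfl)
      · intro k hk
        refine ⟨by simp [hmB, hk], ?_, ?_⟩
        · intro hx
          by_cases hks : π k = s
          · rw [hks, Function.update_self]
            have h3 := (hst k).2.1 hx
            rw [hks] at h3
            exact (hE h3).resolve_left fun h4 => hk ((hPs k hks).2 h4)
          · rw [Function.update_of_ne hks]; exact (hst k).2.1 hx
        · intro hx
          have hks : π k ≠ s := fun e => hx (e ▸ hs)
          have := (hst k).2.2 hx
          dsimp only at this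
          rw [if_neg (fun h => hk ((hPn k hks).2 h))] at this
          exact this
      · intro k hk
        have hk' : P k := not_not.1 hk
        simp [hmB, hk']
    have fin_ev : ∀ Q : ℕ → Prop, ¬ (Set.ofPred Q).Infinite → ∃ N, ∀ k ≥ N, ¬ Q k := by
      intro Q hQ
      obtain ⟨b, hb⟩ := (Set.not_infinite.1 hQ).bddAbove
      exact ⟨b + 1, fun k hk hQk => by have := hb hQk; omega⟩
    by_cases iA : (Set.ofPred P).Infinite
    · by_cases iB : (Set.ofPred fun k => ¬ P k).Infinite
      · convert hL _ _ (hA iA) (hB iB) using 1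
        ext t
        constructor
        · intro h
          by_contra hc
          simp only [Set.mem_union, Set.mem_ofPred_eq, not_or] at hc
          obtain ⟨c1, c2⟩ := hc
          push Not at c1 c2
          obtain ⟨N1, c1⟩ := c1
          obtain ⟨N2, c2⟩ := c2
          obtain ⟨k, hk, e⟩ := h (N1 + N2)
          by_cases hPk : P k
          · exact c1 k (by omega) hPk e
          · exact c2 k (by omega) hPk e
        · rintro (h | h) N
          · obtain ⟨k, a, _, b⟩ := h N; exact ⟨k, a, b⟩
          · obtain ⟨k, a, _, b⟩ := h N; exact ⟨k, a, b⟩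
      · obtain ⟨N0, hN0⟩ := fin_ev _ iB
        convert hA iA using 1
        ext t
        constructor
        · intro h N
          obtain ⟨k, hk, e⟩ := h (N + N0)
          exact ⟨k, by omega, not_not.1 (hN0 k (by omega)), e⟩
        · intro h N
          obtain ⟨k, a, _, b⟩ := h N; exact ⟨k, a, b⟩
    · obtain ⟨N0, hN0⟩ := fin_ev _ iA
      have iB : (Set.ofPred fun k => ¬ P k).Infinite := by
        by_contra hc
        obtain ⟨N1, hN1⟩ := fin_ev _ hc
        exact hN1 (N0 + N1) (by omega) (hN0 (N0 + N1) (by omega))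
      convert hB iB using 1
      ext t
      constructor
      · intro h N
        obtain ⟨k, hk, e⟩ := h (N + N0)
        exact ⟨k, by omega, hN0 k (by omega), e⟩
      · intro h N
        obtain ⟨k, a, _, b⟩ := h N; exact ⟨k, a, b⟩

theorem P1.mono {S1 : Set S} {E E' : S → Set S} {L : Set S → Prop} {s : S}
    (h : P1 S1 E' L s) (h1 : ∀ x ∈ S1, E' x ⊆ E x) (h2 : ∀ x ∉ S1, E' x = E x) :
    P1 S1 E L s := by
  obtain ⟨f, hf, hw⟩ := h
  refine ⟨f, fun x hx => h1 x hx (hf x hx), fun π h0 hst => hw π h0 fun k => ⟨(hst k).1, ?_⟩⟩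
  intro hx
  rw [h2 _ hx]; exact (hst k).2 hx

theorem determined [Fintype S] (S1 : Set S) (L : Set S → Prop)
    (hL : ∀ U V, L U → L V → L (U ∪ V)) (n : ℕ) :
    ∀ (E : S → Set S), (∀ x, (E x).Nonempty) → ∑ x, (E x).ncard = n →
      ∀ s, P1 S1 E L s ∨ W2 S1 E L s := by
  induction n using Nat.strong_induction_on with
  | _ n ih =>
    intro E hne hn sI
    by_cases hsub : ∀ x ∈ S1, (E x).Subsingleton
    · exact base S1 E L sI hne hsub
    push Not at hsub
    obtain ⟨s, hs, hnt⟩ := hsub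
    obtain ⟨t, ht, u, hu, htu⟩ := hnt
    have main : ∀ A : Set S, A ⊂ E s → A.Nonempty → 
        ∀ x, P1 S1 (Function.update E s A) L x ∨ W2 S1 (Function.update E s A) L x := by
      intro A hA hAn
      refine ih _ ?_ (Function.update E s A) ?_ rfl
      · rw [← hn]
        apply Finset.sum_lt_sum
        · intro x _
          by_cases hx : x = s
          · subst hx; rw [Function.update_self]; exact Set.ncard_le_ncard hA.1 (Set.toFinite _)
          · rw [Function.update_of_ne hx]
        · refine ⟨s, Finset.mem_univ _, ?_⟩
          rw [Function.update_self]; exact Set.ncard_lt_ncard hA (Set.toFinite _)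
      · intro x
        by_cases hx : x = s
        · subst hx; rw [Function.update_self]; exact hAn
        · rw [Function.update_of_ne hx]; exact hne x
    have mono : ∀ A : Set S, A ⊂ E s → P1 S1 (Function.update E s A) L sI → P1 S1 E L sI := by
      intro A hA h
      refine h.mono ?_ ?_
      · intro x _
        by_cases hx : x = s
        · subst hx; rw [Function.update_self]; exact hA.1
        · rw [Function.update_of_ne hx]
      · intro x hx
        rw [Function.update_of_ne (by rintro rfl; exact hx hs)]
    have hA : ({t} : Set S) ⊂ E s := by
      refine ⟨by simpa using ht, fun h => htu ?_⟩
      have := h hu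
      simp at this; exact this.symm
    have hB : E s \ {t} ⊂ E s := by
      refine ⟨Set.sdiff_subset, fun h => ?_⟩
      have := h ht
      simp at this
    have hBn : (E s \ {t}).Nonempty := ⟨u, hu, by simpa using htu.symm⟩
    rcases main _ hA (Set.singleton_nonempty t) sI with h1 | h1
    · exact Or.inl (mono _ hA h1)
    rcases main _ hB hBn sI with h2 | h2
    · exact Or.inl (mono _ hB h2)
    right
    rcases main _ hB hBn s with h3 | h3
    · exact avoid S1 E L s sI _ hs h3 h2
    · refine shuffle S1 E L hL s sI _ _ hs ?_ h1 h3
      intro x hx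
      by_cases hxt : x = t
      · left; exact hxt
      · right; exact ⟨hx, hxt⟩

theorem not_W2 [Fintype S] (G : DetGame S) (Φ : Set (ℕ → S)) (L : Set S → Prop)
    (hΦ : ∀ π ∈ Φ, ¬ L (infSet π)) (s : S) (h : s ∈ G.Win1 Φ) :
    ¬ W2 G.S1 (fun x => {y | G.E x y}) L s := by
  rintro ⟨M, m0, upd, ch, hch, hw⟩
  obtain ⟨α, hα⟩ := h
  let u' : Option (M × S) → S → Option (M × S) := fun o y =>
    some (match o with
    | none => (m0, y)
    | some q => (upd q.1 q.2 y, y))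
  let mem : List S → M := fun l => match l.foldl u' none with
    | none => m0
    | some q => q.1
  let β : DetGame.Strat2 G := ⟨fun h x => ch (mem (h ++ [x])) x, fun h x hx => hch _ x hx⟩
  let H := G.histPair α β s
  let F : ℕ → Option (M × S) := fun k => ((H k).1 ++ [(H k).2]).foldl u' none
  have hF0 : F 0 = some (m0, s) := rfl
  have hFs : ∀ k, F (k+1) = u' (F k) (H (k+1)).2 := by
    intro k
    show ((H (k+1)).1 ++ [(H (k+1)).2]).foldl u' none = _
    rw [List.foldl_append]
    rfl
  let m : ℕ → M := fun k => mem ((H k).1 ++ [(H k).2])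
  have hF : ∀ k, F k = some (m k, (H k).2) := by
    have aux : ∀ k, (F k).map Prod.snd = some (H k).2 := by
      intro k
      cases k with
      | zero => rfl
      | succ k =>
        rw [hFs]
        cases F k <;> rfl
    intro k
    have h1 := aux k
    have h2 : m k = match F k with
      | none => m0
      | some q => q.1 := rfl
    cases hh : F k with
    | none => rw [hh] at h1; simp at h1
    | some q =>
      rw [hh] at h1 h2
      simp at h1
      rw [h2, ← h1]
  have hms : ∀ k, m (k+1) = upd (m k) (H k).2 (H (k+1)).2 := by
    intro k
    have h1 := hFs k
    rw [hF, hF] at h1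
    simp only [u', Option.some.injEq, Prod.mk.injEq] at h1
    exact h1.1
  have hL := hw (G.outcome s α β) m rfl (by
      have := hF 0
      rw [hF0] at this
      simp at this
      exact this.1.symm) (by
    intro k
    refine ⟨hms k, ?_, ?_⟩
    · intro hx
      have : G.outcome s α β (k+1) = α.f (H k).1 (H k).2 := if_pos hx
      rw [this]
      exact α.valid _ _ hx
    · intro hx
      exact if_neg hx)
  exact hΦ _ (hα β) hL

/-- interleaving of two sequences -/
def inter (a b : ℕ → S) (k : ℕ) : S := if k % 2 = 0 then a (k / 2) else b (k / 2)

theorem inter_even (a b : ℕ → S) (i : ℕ) : inter a b (2 * i) = a i := by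
  have h1 : 2 * i % 2 = 0 := by omega
  have h2 : 2 * i / 2 = i := by omega
  simp only [inter, h1, h2, if_true]

theorem inter_odd (a b : ℕ → S) (i : ℕ) : inter a b (2 * i + 1) = b i := by
  have h1 : ¬ (2 * i + 1) % 2 = 0 := by omega
  have h2 : (2 * i + 1) / 2 = i := by omega
  simp only [inter, h1, h2, if_false]

theorem inter_play (R : S → S → Prop) (a b : ℕ → S) (h1 : ∀ i, R (a i) (b i))
    (h2 : ∀ i, R (b i) (a (i+1))) (k : ℕ) : R (inter a b k) (inter a b (k+1)) := by
  rcases Nat.even_or_odd' k with ⟨i, rfl | rfl⟩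
  · rw [inter_even, inter_odd]; exact h1 i
  · rw [inter_odd, show 2 * i + 1 + 1 = 2 * (i + 1) by ring, inter_even]; exact h2 i

variable {I O : Type}

theorem word_inter [Fintype S] (SG : SynthGame S I O) (a b : ℕ → S) (i : ℕ) :
    SG.word (inter a b) i = (SG.labI (a (i+1)), SG.labO (b i)) := by
  show (_, _) = _
  rw [show 2 * i + 2 = 2 * (i + 1) by ring, inter_even, inter_odd]

theorem play_parity [Fintype S] (SG : SynthGame S I O) (π : ℕ → S)
    (h : SG.toDetGame.IsPlay π) (h0 : π 0 = SG.sI) (i : ℕ) :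
    π (2 * i) ∈ SG.S1 ∧ π (2 * i + 1) ∉ SG.S1 := by
  have odd : ∀ k, π k ∈ SG.S1 → π (k+1) ∉ SG.S1 := fun k hk => by
    rcases SG.bipartite _ _ (h k) with h | h
    · exact h.2
    · exact absurd hk h.1
  have ev : ∀ k, π k ∉ SG.S1 → π (k+1) ∈ SG.S1 := fun k hk => by
    rcases SG.bipartite _ _ (h k) with h | h
    · exact absurd h.1 hk
    · exact h.2
  have : π (2 * i) ∈ SG.S1 := by
    induction i with
    | zero => rw [Nat.mul_zero, h0]; exact SG.sI_mem
    | succ i ih => exact ev _ (odd _ ih)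
  exact ⟨this, odd _ this⟩

theorem play_unique [Fintype S] (SG : SynthGame S I O) (π ρ : ℕ → S)
    (h : SG.toDetGame.IsPlay π) (h0 : π 0 = SG.sI)
    (g : SG.toDetGame.IsPlay ρ) (g0 : ρ 0 = SG.sI) (hw : SG.word π = SG.word ρ) : π = ρ := by
  have key : ∀ i, π (2 * i) = ρ (2 * i) ∧ π (2 * i + 1) = ρ (2 * i + 1) := by
    have step : ∀ i, π (2 * i) = ρ (2 * i) → π (2 * i + 1) = ρ (2 * i + 1) := by
      intro i hi
      have hl := congrArg Prod.snd (congrFun hw i)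
      refine SG.labelDet1 _ _ _ (play_parity SG π h h0 i).1 (h _) ?_ hl
      rw [hi]; exact g _
    intro i
    induction i with
    | zero =>
      have : π (2 * 0) = ρ (2 * 0) := by rw [Nat.mul_zero, h0, g0]
      exact ⟨this, step 0 this⟩
    | succ i ih =>
      have : π (2 * (i+1)) = ρ (2 * (i+1)) := by
        have hl := congrArg Prod.fst (congrFun hw i)
        refine SG.labelDet2 _ _ _ (play_parity SG π h h0 i).2 (h _) ?_ hl
        rw [ih.2]; exact g _
      exact ⟨this, step _ this⟩
  funext k
  rcases Nat.even_or_odd' k with ⟨i, rfl | rfl⟩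
  · exact (key i).1
  · exact (key i).2

theorem env [Fintype S] (SG : SynthGame S I O) (El : Set (S × S))
    (hEl : El ⊆ SG.toDetGame.E2) : EnvRealizable (SG.psiFair El) := by
  obtain ⟨n, ⟨e⟩⟩ : ∃ n, Nonempty (S ≃ Fin (n+1)) := by
    have : Fintype.card S ≠ 0 := by
      have : Nonempty S := ⟨SG.sI⟩
      exact Fintype.card_ne_zero
    obtain ⟨n, hn⟩ := Nat.exists_eq_succ_of_ne_zero this
    exact ⟨n, ⟨Fintype.equivFinOfCardEq hn⟩⟩
  have c1 : ∀ (s : S) (o : Set O), ∃ t, s ∈ SG.S1 → SG.E s t ∧ SG.labO t = o := by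
    intro s o
    by_cases hs : s ∈ SG.S1
    · obtain ⟨t, ht⟩ := SG.complete1 s hs o; exact ⟨t, fun _ => ht⟩
    · exact ⟨s, fun h => absurd h hs⟩
  choose nx hnx using c1
  choose ds hds using SG.exists_succ
  let tgt : S → Fin (n+1) → S := fun u c => if SG.E u (e.symm c) then e.symm c else ds u
  have htgt : ∀ u c, SG.E u (tgt u c) := by
    intro u c
    simp only [tgt]
    split_ifs with h
    · exact h
    · exact hds u
  let T : Mealy I O :=
    { Q := S × (S → Fin (n+1))
      fin := inferInstance
      qI := (SG.sI, fun _ => 0)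
      tr := fun q o => (tgt (nx q.1 o) (q.2 (nx q.1 o)),
        Function.update q.2 (nx q.1 o) (q.2 (nx q.1 o) + 1))
      out := fun q o => SG.labI (tgt (nx q.1 o) (q.2 (nx q.1 o))) }
  refine ⟨T, ?_⟩
  rintro x ⟨w, rfl⟩
  let q : ℕ → S × (S → Fin (n+1)) := T.run w
  let a : ℕ → S := fun i => (q i).1
  let b : ℕ → S := fun i => nx (a i) (w i)
  have hq : ∀ i, q (i+1) = (tgt (b i) ((q i).2 (b i)),
      Function.update (q i).2 (b i) ((q i).2 (b i) + 1)) := fun i => rfl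
  have ha : ∀ i, a (i+1) = tgt (b i) ((q i).2 (b i)) := fun i => rfl
  have haS : ∀ i, a i ∈ SG.S1 := by
    intro i
    induction i with
    | zero => exact SG.sI_mem
    | succ i ih =>
      have h1 := (hnx (a i) (w i) ih).1
      have h2 : nx (a i) (w i) ∉ SG.S1 := by
        rcases SG.bipartite _ _ h1 with h | h
        · exact h.2
        · exact absurd ih h.1
      rcases SG.bipartite _ _ (htgt (b i) ((q i).2 (b i))) with h | h
      · exact absurd h.1 h2
      · exact h.2
  have hplay : SG.toDetGame.IsPlay (inter a b) :=
    inter_play SG.E a b (fun i => (hnx _ _ (haS i)).1) (fun i => htgt _ _)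
  refine ⟨inter a b, hplay, inter_even a b 0, ?_, ?_⟩
  · funext i
    rw [word_inter]
    show _ = (SG.labI (a (i+1)), w i)
    rw [(hnx (a i) (w i) (haS i)).2]
  · rintro ⟨u, t⟩ het
    obtain ⟨hE, hu⟩ := hEl het
    by_cases hinf : u ∈ infSet (inter a b)
    · right
      intro N
      let P : ℕ → Prop := fun i => b i = u
      have hP : (Set.ofPred P).Infinite := by
        rw [Set.infinite_iff_exists_gt]
        intro m
        obtain ⟨k, hk, ek⟩ := hinf (2 * (m + 1))
        rcases Nat.even_or_odd' k with ⟨i, rfl | rfl⟩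
        · rw [inter_even] at ek
          exact absurd (ek ▸ haS i) hu
        · rw [inter_odd] at ek
          exact ⟨i, ek, by omega⟩
      have hcnt : ∀ i, (q i).2 u = Fin.ofNat (n+1) (Nat.count P i) := by
        intro i
        induction i with
        | zero => simp; rfl
        | succ i ih =>
          rw [hq, Nat.count_succ]
          by_cases hb : b i = u
          · have : P i := hb
            simp only [hb, Function.update_self, this, if_true, ih]
            apply Fin.ext
            simp [Fin.val_add]
          · have : ¬ P i := hb
            simp only [Function.update_of_ne (Ne.symm hb), this, if_false, ih, add_zero]
      let j := N * (n+1) + (e t).val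
      let i := Nat.nth P j
      have hPi : b i = u := Nat.nth_mem_of_infinite hP j
      have hij : j ≤ i := (Nat.nth_strictMono hP).le_apply
      refine ⟨2 * i + 1, ?_, ?_, ?_⟩
      · have : N ≤ j := by simp only [j]; nlinarith [Nat.zero_le (e t).val, Nat.zero_le (N * n)]
        omega
      · rw [inter_odd]; exact hPi
      · rw [show 2 * i + 1 + 1 = 2 * (i + 1) by ring, inter_even, ha, hPi, hcnt,
          Nat.count_nth_of_infinite hP]
        have hj : Fin.ofNat (n+1) j = e t := by
          apply Fin.ext
          show j % (n+1) = _
          simp only [j]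
          rw [Nat.mul_comm, Nat.mul_add_mod]
          exact Nat.mod_eq_of_lt (e t).isLt
        rw [hj]
        simp only [tgt, Equiv.symm_apply_apply]
        exact if_pos hE
    · exact Or.inl hinf

end RG

theorem fair_assumption_sufficient {S I O : Type} [Fintype S] [Fintype I]
    [Fintype O] (SG : SynthGame S I O) (p : S → ℕ)
    (φ : Set (ℕ → Set I × Set O)) (hfor : SG.IsGameFor p φ)
    (El : Set (S × S)) (hEl : El ⊆ SG.toDetGame.E2)
    (hsuff : SG.sI ∈ SG.toDetGame.Win1
      (SG.toDetGame.AssumeFair El (ParityObj p))) :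
    SufficientAssumption φ (SG.psiFair El) ∧ EnvRealizable (SG.psiFair El) := by
  refine ⟨?_, RG.env SG El hEl⟩
  let L : Set S → Prop := fun U =>
    (∀ e ∈ El, e.1 ∈ U → e.2 ∈ U) ∧ ¬ Even (sInf (p '' U))
  have hL : ∀ U V, L U → L V → L (U ∪ V) := by
    rintro U V ⟨hU1, hU2⟩ ⟨hV1, hV2⟩
    refine ⟨fun e he h => h.imp (hU1 e he) (hV1 e he), ?_⟩
    have hUn : (p '' U).Nonempty := by
      by_contra h
      rw [Set.not_nonempty_iff_eq_empty] at h
      rw [h] at hU2; simp at hU2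
    have hVn : (p '' V).Nonempty := by
      by_contra h
      rw [Set.not_nonempty_iff_eq_empty] at h
      rw [h] at hV2; simp at hV2
    rw [Set.image_union, csInf_union (OrderBot.bddBelow _) hUn (OrderBot.bddBelow _) hVn]
    rcases min_choice (sInf (p '' U)) (sInf (p '' V)) with h | h
    · intro hh; exact hU2 (h ▸ hh)
    · intro hh; exact hV2 (h ▸ hh)
  have hnot := RG.not_W2 SG.toDetGame _ L (by
    rintro π (⟨e, he, h1, h2⟩ | hπ) ⟨l1, l2⟩
    · exact h2 (l1 e he h1)
    · exact l2 hπ) SG.sI hsuff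
  obtain ⟨f, hf, hw⟩ := (RG.determined SG.S1 L hL _ (fun x => {y | SG.E x y})
    SG.exists_succ rfl SG.sI).resolve_right hnot
  have c2 : ∀ (s : S) (i : Set I), ∃ t, s ∉ SG.S1 → SG.E s t ∧ SG.labI t = i := by
    intro s i
    by_cases hs : s ∈ SG.S1
    · exact ⟨s, fun h => absurd hs h⟩
    · obtain ⟨t, ht⟩ := SG.complete2 s hs i; exact ⟨t, fun _ => ht⟩
  choose nx hnx using c2
  let T : Moore I O :=
    { Q := S
      fin := inferInstance
      qI := SG.sI
      tr := fun q i => nx (f q) i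
      out := fun q => SG.labO (f q) }
  refine ⟨T, ?_⟩
  rintro x ⟨w, rfl⟩
  let a : ℕ → S := T.run w
  let b : ℕ → S := fun i => f (a i)
  have ha : ∀ i, a (i+1) = nx (b i) (w i) := fun i => rfl
  have hbS : ∀ i, a i ∈ SG.S1 → b i ∉ SG.S1 := by
    intro i hi
    rcases SG.bipartite _ _ (hf (a i) hi) with h | h
    · exact h.2
    · exact absurd hi h.1
  have haS : ∀ i, a i ∈ SG.S1 := by
    intro i
    induction i with
    | zero => exact SG.sI_mem
    | succ i ih =>
      rcases SG.bipartite _ _ (hnx (b i) (w i) (hbS i ih)).1 with h | h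
      · exact absurd h.1 (hbS i ih)
      · exact h.2
  have hplay : SG.toDetGame.IsPlay (RG.inter a b) :=
    RG.inter_play SG.E a b (fun i => hf _ (haS i))
      (fun i => (hnx (b i) (w i) (hbS i (haS i))).1)
  have h0 : RG.inter a b 0 = SG.sI := RG.inter_even a b 0
  have hword : SG.word (RG.inter a b) = T.output w := by
    funext i
    rw [RG.word_inter, ha, (hnx (b i) (w i) (hbS i (haS i))).2]
    rfl
  have hnL := hw (RG.inter a b) h0 (by
    intro k
    refine ⟨?_, fun _ => hplay k⟩
    rcases Nat.even_or_odd' k with ⟨i, rfl | rfl⟩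
    · intro _; rw [RG.inter_even, RG.inter_odd]
    · intro h; rw [RG.inter_odd] at h; exact absurd h (hbS i (haS i)))
  by_cases hψ : T.output w ∈ SG.psiFair El
  · right
    obtain ⟨ρ, hρ, hρ0, hρw, hfair⟩ := hψ
    have hρe : ρ = RG.inter a b :=
      RG.play_unique SG _ _ hρ hρ0 hplay h0 (hρw.trans hword.symm)
    subst hρe
    rw [← hword]
    refine (hfor _ hplay h0).1 ?_
    by_contra hc
    refine hnL ⟨?_, hc⟩
    intro e he h1
    intro N
    obtain ⟨k, hk, _, e2⟩ := (hfair e he).resolve_left (fun h => h h1) N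
    exact ⟨k+1, by omega, e2⟩
  · left; exact hψ
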